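/- arXiv:1405.4663 — 5 statements merged into one kernel-verified Lean document; each statement's English description precedes it below -/
import Mathlib

section
/- Let f be a polynomial map of degree d ≥ 2 over ℂ_p, let z_0 ∈ ℂ_p and δ > 0 be such that f' has no zeros in D̄_δ(z_0), and set μ := min{|l|^{1/(l−1)} : l ∈ {2,…,d}} · δ, where |l| is the p-adic absolute value of the integer l. Then for every r with 0 < r ≤ μ and all x, y ∈ D̄_r(z_0), one has |f(x) − f(y)| = |f'(z_0)| · |x − y|. -/
open Polynomial

noncomputable section

/-- The projective line over `K`: `K` together with a point at infinity (`none`). -/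
def P1 (K : Type*) := Option K

variable {K : Type*}

/-- Inclusion of `K` into the projective line. -/
def toP1 : K → P1 K := some

/-- The point at infinity of the projective line. -/
def P1.infty : P1 K := none

/-- The extension of a polynomial map to the projective line, sending `∞` to `∞`. -/
def polyMap [CommRing K] (f : K[X]) : P1 K → P1 K :=
  fun z => Option.map (fun w => f.eval w) z

/-- The chordal metric on the projective line over a normed field. -/
def chordal [NormedField K] (x y : P1 K) : ℝ :=
  match x, y with
  | some z, some w => ‖z - w‖ / (max ‖z‖ 1 * max ‖w‖ 1)
  | some z, none => 1 / max ‖z‖ 1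
  | none, some w => 1 / max ‖w‖ 1
  | none, none => 0

/-- A subset of the projective line is `ρ`-open if around each of its points it contains a
ball with respect to the chordal metric. -/
def IsRhoOpen [NormedField K] (U : Set (P1 K)) : Prop :=
  ∀ x ∈ U, ∃ ε > 0, ∀ y, chordal x y < ε → y ∈ U

/-- The topology on the projective line induced by the chordal metric. -/
instance P1.instTopologicalSpace (K : Type*) [NormedField K] : TopologicalSpace (P1 K) where
  IsOpen := IsRhoOpen
  isOpen_univ := fun _ _ => ⟨1, one_pos, fun _ _ => trivial⟩
  isOpen_inter := fun U V hU hV x hx => by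
    obtain ⟨ε₁, hε₁, h₁⟩ := hU x hx.1
    obtain ⟨ε₂, hε₂, h₂⟩ := hV x hx.2
    exact ⟨min ε₁ ε₂, lt_min hε₁ hε₂, fun y hy =>
      ⟨h₁ y (lt_of_lt_of_le hy (min_le_left _ _)), h₂ y (lt_of_lt_of_le hy (min_le_right _ _))⟩⟩
  isOpen_sUnion := fun S hS x hx => by
    obtain ⟨U, hUS, hxU⟩ := hx
    obtain ⟨ε, hε, h⟩ := hS U hUS x hxU
    exact ⟨ε, hε, fun y hy => ⟨U, hUS, h y hy⟩⟩

/-- The Fatou set of a polynomial map: the largest `ρ`-open subset of the projective line on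
which the family of iterates is equicontinuous with respect to the chordal metric. -/
def fatou [NormedField K] (f : K[X]) : Set (P1 K) :=
  {x | ∃ U : Set (P1 K), x ∈ U ∧ IsRhoOpen U ∧
    ∀ y ∈ U, ∀ ε > 0, ∃ δ > 0, ∀ z : P1 K, chordal y z < δ →
      ∀ n : ℕ, chordal ((polyMap f)^[n] y) ((polyMap f)^[n] z) < ε}

/-- The Julia set of a polynomial map: the complement of the Fatou set. -/
def julia [NormedField K] (f : K[X]) : Set (P1 K) :=
  (fatou f)ᶜ

/-- The dynamics of `f` and `g` on their Julia sets are conjugate: there is a homeomorphism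
`h : J(f) → J(g)` with `h ∘ f = g ∘ h` on `J(f)`. -/
def JuliaConjugate [NormedField K] (f g : K[X]) : Prop :=
  ∃ h : (julia f) ≃ₜ (julia g),
    ∀ (z : P1 K) (hz : z ∈ julia f), ∃ hfz : polyMap f z ∈ julia f,
      (h ⟨polyMap f z, hfz⟩ : P1 K) = polyMap g (h ⟨z, hz⟩)

/-- `min {|l|^{1/(l-1)} : 2 ≤ l ≤ d}` where `|l|` is the `p`-adic absolute value of `l`. -/
def muFactor (p : ℕ) [Fact (Nat.Prime p)] (d : ℕ) : ℝ :=
  sInf {x : ℝ | ∃ l : ℕ, 2 ≤ l ∧ l ≤ d ∧ x = ‖(l : ℚ_[p])‖ ^ ((1 : ℝ) / ((l : ℝ) - 1))}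

section NonarchimedeanPolynomials

variable {K : Type*} [NormedField K] [IsUltrametricDist K]

/-- The constant term strictly dominates all other terms on the disk of radius `δ` about `0`. -/
def ConstantTermDominates (δ : ℝ) (h : K[X]) : Prop :=
  ∀ n, ‖h.coeff (n + 1)‖ * δ ^ (n + 1) < ‖h.coeff 0‖

theorem ConstantTermDominates.X_sub_C_mul {δ : ℝ} (hδ : 0 < δ) {h : K[X]}
    (hh : ConstantTermDominates δ h) {s : K} (hs : δ < ‖s‖) :
    ConstantTermDominates δ ((X - C s) * h) := by
  have h0 : 0 < ‖h.coeff 0‖ := lt_of_le_of_lt (by positivity) (hh 0)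
  have hle : ∀ n, ‖h.coeff n‖ * δ ^ n ≤ ‖h.coeff 0‖ := by
    rintro (_ | n)
    · simp
    · exact (hh n).le
  intro n
  have hc0 : ((X - C s) * h).coeff 0 = -(s * h.coeff 0) := by simp [sub_mul]
  have hcn : ((X - C s) * h).coeff (n + 1) = h.coeff n - s * h.coeff (n + 1) := by
    simp [sub_mul, coeff_X_mul]
  rw [hc0, hcn, norm_neg, norm_mul]
  have hδn : 0 < δ ^ (n + 1) := by positivity
  rw [← lt_div_iff₀ hδn, sub_eq_add_neg]
  refine lt_of_le_of_lt (IsUltrametricDist.norm_add_le_max _ _) (max_lt ?_ ?_)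
  · rw [lt_div_iff₀ hδn]
    calc ‖h.coeff n‖ * δ ^ (n + 1) = δ * (‖h.coeff n‖ * δ ^ n) := by ring
      _ ≤ δ * ‖h.coeff 0‖ := by gcongr; exact hle n
      _ < ‖s‖ * ‖h.coeff 0‖ := by gcongr
  · rw [lt_div_iff₀ hδn, norm_neg, norm_mul, mul_assoc]
    exact mul_lt_mul_of_pos_left (hh n) (hδ.trans hs)

theorem constantTermDominates_of_eval_ne_zero [IsAlgClosed K] {δ : ℝ} (hδ : 0 < δ) {h : K[X]}
    (hne : ∀ z, ‖z‖ ≤ δ → h.eval z ≠ 0) : ConstantTermDominates δ h := by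
  have h0 : h ≠ 0 := by
    rintro rfl
    exact hne 0 (by simpa using hδ.le) (by simp)
  have hprod (m : Multiset K) (hm : ∀ s ∈ m, δ < ‖s‖) :
      ConstantTermDominates δ (C h.leadingCoeff * (m.map fun s => X - C s).prod) := by
    induction m using Multiset.induction_on with
    | empty =>
      intro n
      simpa [coeff_C] using h0
    | cons s m ih =>
      rw [Multiset.map_cons, Multiset.prod_cons, mul_left_comm]
      exact (ih fun t ht => hm t (Multiset.mem_cons_of_mem ht)).X_sub_C_mul hδ
        (hm s (Multiset.mem_cons_self s m))
  rw [(IsAlgClosed.splits h).eq_prod_roots]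
  refine hprod _ fun s hs => ?_
  by_contra! hle
  exact hne s hle (isRoot_of_mem_roots hs)

theorem norm_pow_succ_sub_pow_succ_le {r : ℝ} {x y : K} (hx : ‖x‖ ≤ r) (hy : ‖y‖ ≤ r) (n : ℕ) :
    ‖x ^ (n + 1) - y ^ (n + 1)‖ ≤ ‖x - y‖ * r ^ n := by
  have hr : 0 ≤ r := (norm_nonneg x).trans hx
  induction n with
  | zero => simp
  | succ n ih =>
    have hsplit : x ^ (n + 1 + 1) - y ^ (n + 1 + 1)
        = x * (x ^ (n + 1) - y ^ (n + 1)) + (x - y) * y ^ (n + 1) := by ring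
    rw [hsplit]
    refine (IsUltrametricDist.norm_add_le_max _ _).trans (max_le ?_ ?_)
    · rw [norm_mul]
      calc ‖x‖ * ‖x ^ (n + 1) - y ^ (n + 1)‖ ≤ r * (‖x - y‖ * r ^ n) := by gcongr
        _ = ‖x - y‖ * r ^ (n + 1) := by ring
    · rw [norm_mul, norm_pow]
      gcongr

theorem norm_eval_sub_eval_of_linear_coeff_dominates {g : K[X]} {r : ℝ}
    (hg : ∀ n, ‖g.coeff (n + 2)‖ * r ^ (n + 1) < ‖g.coeff 1‖)
    {x y : K} (hx : ‖x‖ ≤ r) (hy : ‖y‖ ≤ r) :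
    ‖g.eval x - g.eval y‖ = ‖g.coeff 1‖ * ‖x - y‖ := by
  rcases eq_or_ne x y with rfl | hxy
  · simp
  have hpos : 0 < ‖x - y‖ := norm_pos_iff.2 (sub_ne_zero.2 hxy)
  have hr : 0 ≤ r := (norm_nonneg x).trans hx
  have h1 : 0 < ‖g.coeff 1‖ := lt_of_le_of_lt (by positivity) (hg 0)
  have hN : g.natDegree < g.natDegree + 2 := by omega
  have hexp : g.eval x - g.eval y = g.coeff 1 * (x - y) +
      ∑ n ∈ Finset.range g.natDegree, g.coeff (n + 2) * (x ^ (n + 2) - y ^ (n + 2)) := by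
    rw [eval_eq_sum_range' hN, eval_eq_sum_range' hN, ← Finset.sum_sub_distrib,
      Finset.sum_range_succ', Finset.sum_range_succ']
    simp only [mul_sub]
    ring
  have hsum : ‖∑ n ∈ Finset.range g.natDegree, g.coeff (n + 2) * (x ^ (n + 2) - y ^ (n + 2))‖
      < ‖g.coeff 1 * (x - y)‖ := by
    have hlt : 0 < ‖g.coeff 1 * (x - y)‖ := by rw [norm_mul]; positivity
    rcases (Finset.range g.natDegree).eq_empty_or_nonempty with he | hne
    · simpa [he] using hlt
    obtain ⟨n, -, hn⟩ := IsUltrametricDist.exists_norm_finsetSum_le_of_nonempty hne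
      fun n => g.coeff (n + 2) * (x ^ (n + 2) - y ^ (n + 2))
    refine hn.trans_lt ?_
    rw [norm_mul, norm_mul]
    calc ‖g.coeff (n + 2)‖ * ‖x ^ (n + 2) - y ^ (n + 2)‖
        ≤ ‖g.coeff (n + 2)‖ * (‖x - y‖ * r ^ (n + 1)) := by
          gcongr
          exact norm_pow_succ_sub_pow_succ_le hx hy (n + 1)
      _ = ‖g.coeff (n + 2)‖ * r ^ (n + 1) * ‖x - y‖ := by ring
      _ < ‖g.coeff 1‖ * ‖x - y‖ := mul_lt_mul_of_pos_right (hg n) hpos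
  rw [hexp, IsUltrametricDist.norm_add_eq_max_of_norm_ne_norm hsum.ne', max_eq_left hsum.le,
    norm_mul]

end NonarchimedeanPolynomials

theorem muFactor_pow_le (p : ℕ) [Fact (Nat.Prime p)] {d n : ℕ} (hn : n + 2 ≤ d) :
    muFactor p d ^ (n + 1) ≤ ‖((n + 2 : ℕ) : ℚ_[p])‖ := by
  have hnonneg : 0 ≤ muFactor p d := by
    refine Real.sInf_nonneg ?_
    rintro _ ⟨l, -, -, rfl⟩
    positivity
  have hle : muFactor p d ≤ ‖((n + 2 : ℕ) : ℚ_[p])‖ ^ ((1 : ℝ) / (((n + 2 : ℕ) : ℝ) - 1)) := by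
    refine csInf_le ⟨0, ?_⟩ ⟨n + 2, by omega, hn, rfl⟩
    rintro _ ⟨l, -, -, rfl⟩
    positivity
  have hexp : (1 : ℝ) / (((n + 2 : ℕ) : ℝ) - 1) = ((n + 1 : ℕ) : ℝ)⁻¹ := by
    rw [one_div]
    push_cast
    ring_nf
  rw [hexp] at hle
  exact (pow_le_pow_left₀ hnonneg hle _).trans_eq
    (Real.rpow_inv_natCast_pow (norm_nonneg _) n.succ_ne_zero)

/-- **Proposition 3.3.** If `f'` has no zeros in `D̄_δ(z₀)` and
`μ := min {|l|^{1/(l-1)} : 2 ≤ l ≤ d} · δ`, then for every `0 < r ≤ μ` and all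
`x, y ∈ D̄_r(z₀)` one has `|f(x) - f(y)| = |f'(z₀)|·|x - y|`. -/
theorem isometry_scaling_on_small_disk
    {p : ℕ} [Fact (Nat.Prime p)] {K : Type*} [NormedField K] [IsAlgClosed K]
    [CompleteSpace K] [IsUltrametricDist K] [Algebra ℚ_[p] K]
    (hext : ∀ q : ℚ_[p], ‖algebraMap ℚ_[p] K q‖ = ‖q‖)
    (d : ℕ) (hd : 2 ≤ d) (f : K[X]) (hdeg : f.natDegree = d)
    (z₀ : K) (δ : ℝ) (hδ : 0 < δ)
    (hder : ∀ z ∈ Metric.closedBall z₀ δ, (derivative f).eval z ≠ 0) :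
    ∀ r : ℝ, 0 < r → r ≤ muFactor p d * δ →
      ∀ x ∈ Metric.closedBall z₀ r, ∀ y ∈ Metric.closedBall z₀ r,
        ‖f.eval x - f.eval y‖ = ‖(derivative f).eval z₀‖ * ‖x - y‖ := by
  intro r hr hrμ x hx y hy
  set g : K[X] := f.comp (X + C z₀) with hg
  have hg' : derivative g = (derivative f).comp (X + C z₀) := by simp [hg, derivative_comp]
  have hdom : ConstantTermDominates δ (derivative g) := by
    refine constantTermDominates_of_eval_ne_zero hδ fun z hz => ?_
    rw [hg', eval_comp]
    exact hder _ (by simpa [dist_eq_norm] using hz)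
  have hcoeff : ∀ n, ‖g.coeff (n + 2)‖ * r ^ (n + 1) < ‖g.coeff 1‖ := by
    intro n
    have hn := hdom n
    simp only [coeff_derivative, Nat.cast_zero, zero_add, mul_one] at hn
    by_cases hnd : n + 2 ≤ d
    · have hnorm : ‖((n + 1 : ℕ) : K) + 1‖ = ‖((n + 2 : ℕ) : ℚ_[p])‖ := by
        rw [← hext, map_natCast]
        congr 1
        push_cast
        ring
      rw [norm_mul, hnorm] at hn
      refine lt_of_le_of_lt ?_ hn
      rw [mul_assoc]
      gcongr
      calc r ^ (n + 1) ≤ (muFactor p d * δ) ^ (n + 1) := by gcongr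
        _ = muFactor p d ^ (n + 1) * δ ^ (n + 1) := mul_pow _ _ _
        _ ≤ ‖((n + 2 : ℕ) : ℚ_[p])‖ * δ ^ (n + 1) := by
          gcongr
          exact muFactor_pow_le p hnd
    · have hz : g.coeff (n + 2) = 0 := by
        apply coeff_eq_zero_of_natDegree_lt
        rw [hg, natDegree_comp, natDegree_X_add_C, hdeg]
        omega
      rw [hz] at hn ⊢
      simpa using hn
  have hg1 : g.coeff 1 = (derivative f).eval z₀ := by
    have h := coeff_derivative g 0
    rw [hg', coeff_zero_eq_eval_zero, eval_comp] at h
    simpa using h.symm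
  have key := norm_eval_sub_eval_of_linear_coeff_dominates hcoeff
    (mem_closedBall_iff_norm.1 hx) (mem_closedBall_iff_norm.1 hy)
  rw [hg1] at key
  simpa [hg, eval_comp] using key
end
end

section
/- Let f be a polynomial map of degree d ≥ 2 over ℂ_p with non-empty Julia set J(f), and let λ > 1 satisfy |f'(z)| ≥ λ for all z ∈ J(f). Let C(f) be the set consisting of all critical points of f in ℂ_p (zeros of f') together with their images under f (the critical values), let δ > 0 satisfy D̄_δ(c) ∩ J(f) = ∅ for every c ∈ C(f), set μ := min{|k|^{1/(k−1)} : k ∈ {2,…,d}} · δ, and define B := ⋃_{z ∈ J(f)} D̄_μ(z). Then |f'(z)| ≥ λ for every z ∈ B. -/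
open Polynomial

noncomputable section

variable {K : Type*}

/-- Away from its roots, the absolute value of a split polynomial is locally constant, at the
scale given by the distance to the roots. -/
theorem norm_eval_eq_of_forall_mem_roots [NormedField K] [IsUltrametricDist K] {g : K[X]}
    (hg : g.Splits) {z w : K} (h : ∀ r ∈ g.roots, ‖w - z‖ < ‖z - r‖) :
    ‖g.eval w‖ = ‖g.eval z‖ := by
  have key (x : K) : ‖g.eval x‖ = ‖g.leadingCoeff‖ * (g.roots.map fun r => ‖x - r‖).prod := by
    rw [hg.eval_eq_prod_roots, norm_mul]
    congr 1
    have := Multiset.prod_hom (g.roots.map fun r => x - r) (normHom : K →*₀ ℝ)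
    simpa [Multiset.map_map, Function.comp_def] using this.symm
  rw [key, key]
  congr 2
  refine Multiset.map_congr rfl fun r hr => ?_
  have := IsUltrametricDist.norm_add_eq_max_of_norm_ne_norm (h r hr).ne
  rwa [sub_add_sub_cancel, max_eq_right (h r hr).le] at this

theorem muFactor_le_one (p : ℕ) [Fact (Nat.Prime p)] {d : ℕ} (hd : 2 ≤ d) : muFactor p d ≤ 1 := by
  unfold muFactor
  refine csInf_le_of_le ⟨0, ?_⟩ ⟨2, le_rfl, hd, rfl⟩ ?_
  · rintro _ ⟨l, -, -, rfl⟩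
    positivity
  · have : ‖((2 : ℕ) : ℚ_[p])‖ ≤ 1 := by simpa using Padic.norm_int_le_one (p := p) 2
    exact Real.rpow_le_one (norm_nonneg _) this (by norm_num)

/-- **Proposition 3.4.** Let `f` be immediately expanding with constant `λ > 1`, let
`C(f)` be the set of critical points and critical values of `f`, let `δ > 0` satisfy
`D̄_δ(c) ∩ J(f) = ∅` for all `c ∈ C(f)`, let `μ := min {|k|^{1/(k-1)} : 2 ≤ k ≤ d} · δ`
and `B := ⋃_{z ∈ J(f)} D̄_μ(z)`. Then `|f'| ≥ λ` on `B`. -/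
theorem expanding_on_neighborhood_of_julia
    {p : ℕ} [Fact (Nat.Prime p)] {K : Type*} [NormedField K] [IsAlgClosed K]
    [CompleteSpace K] [IsUltrametricDist K] [Algebra ℚ_[p] K]
    (hext : ∀ q : ℚ_[p], ‖algebraMap ℚ_[p] K q‖ = ‖q‖)
    (d : ℕ) (hd : 2 ≤ d) (f : K[X]) (hdeg : f.natDegree = d)
    (hJ : (julia f).Nonempty)
    (lam : ℝ) (hlam : 1 < lam)
    (hexp : ∀ z : K, toP1 z ∈ julia f → lam ≤ ‖(derivative f).eval z‖)
    (δ : ℝ) (hδ : 0 < δ)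
    (hδJ : ∀ c : K,
      (c ∈ {z : K | (derivative f).eval z = 0} ∪
        (fun z => f.eval z) '' {z : K | (derivative f).eval z = 0}) →
      ∀ w ∈ Metric.closedBall c δ, toP1 w ∉ julia f) :
    ∀ w : K, (∃ z : K, toP1 z ∈ julia f ∧ w ∈ Metric.closedBall z (muFactor p d * δ)) →
      lam ≤ ‖(derivative f).eval w‖ := by
  rintro w ⟨z, hz, hw⟩
  refine (hexp z hz).trans_eq (norm_eval_eq_of_forall_mem_roots
    (IsAlgClosed.splits (derivative f)) fun r hr => ?_).symm
  have hzr : δ < ‖z - r‖ := by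
    by_contra! hle
    exact hδJ r (Or.inl (isRoot_of_mem_roots hr)) z (mem_closedBall_iff_norm.2 hle) hz
  calc ‖w - z‖ ≤ muFactor p d * δ := mem_closedBall_iff_norm.1 hw
    _ ≤ δ := mul_le_of_le_one_left hδ.le (muFactor_le_one p hd)
    _ < ‖z - r‖ := hzr
end
end

section
/- Let f be a polynomial map of degree d ≥ 2 over ℂ_p with non-empty Julia set J(f), and let λ > 1 satisfy |f'(z)| ≥ λ for all z ∈ J(f). Let C(f) be the set consisting of all critical points of f in ℂ_p (zeros of f') together with their images under f (the critical values), let δ > 0 satisfy D̄_δ(c) ∩ J(f) = ∅ for every c ∈ C(f), set μ := min{|k|^{1/(k−1)} : k ∈ {2,…,d}} · δ, and define B := ⋃_{z ∈ J(f)} D̄_μ(z). Then B is backward invariant under f, i.e. f⁻¹(B) ⊆ B. -/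
open Polynomial

noncomputable section

variable {K : Type*}

theorem chordal_toP1_le_norm_sub [NormedField K] (z w : K) :
    chordal (toP1 z) (toP1 w) ≤ ‖z - w‖ :=
  div_le_self (norm_nonneg _) (one_le_mul_of_one_le_of_one_le (le_max_right _ _) (le_max_right _ _))

/-- Chordal balls around a finite point are eventually contained in its norm balls. -/
theorem exists_chordal_lt_imp_norm_sub_lt [NormedField K] (z : K) {ε : ℝ} (hε : 0 < ε) :
    ∃ η > 0, ∀ y : P1 K, chordal (toP1 z) y < η → ∃ w, y = toP1 w ∧ ‖z - w‖ < ε := by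
  obtain ⟨M, hM⟩ : ∃ M, M = max ‖z‖ 1 := ⟨_, rfl⟩
  have hzM : ‖z‖ ≤ M := hM ▸ le_max_left _ _
  have hM1 : 1 ≤ M := hM ▸ le_max_right _ _
  have hM0 : 0 < M := by linarith
  refine ⟨min (1 / (2 * M)) (ε / (2 * M ^ 2)), by positivity, fun y hy => ?_⟩
  obtain ⟨h₁, h₂⟩ := lt_min_iff.1 hy
  rcases y with _ | w
  · have h : 1 / M < 1 / (2 * M) := by simpa [chordal, toP1, hM] using h₁
    rw [div_lt_div_iff₀ hM0 (by positivity)] at h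
    linarith
  · refine ⟨w, rfl, ?_⟩
    obtain ⟨N, hN⟩ : ∃ N, N = max ‖w‖ 1 := ⟨_, rfl⟩
    have hN0 : 0 < N := hN ▸ lt_max_of_lt_right one_pos
    have hNM : N ≤ M + ‖z - w‖ := by
      refine hN ▸ max_le ?_ (by linarith [norm_nonneg (z - w)])
      linarith [norm_sub_norm_le w z, norm_sub_rev w z]
    change ‖z - w‖ / (max ‖z‖ 1 * max ‖w‖ 1) < _ at h₁ h₂
    rw [← hM, ← hN, div_lt_div_iff₀ (by positivity) (by positivity)] at h₁ h₂
    have h₃ : ‖z - w‖ * 2 < N := by nlinarith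
    have h₄ : ‖z - w‖ * (2 * M) < ε * N := by nlinarith
    nlinarith

theorem Polynomial.Splits.eval_derivative_of_mem_roots {R : Type*} [CommRing R] [IsDomain R]
    [DecidableEq R] {g : R[X]} (hg : g.Splits) {x : R} (hx : x ∈ g.roots) :
    (derivative g).eval x = g.leadingCoeff * ((g.roots.erase x).map (x - ·)).prod := by
  conv_lhs => rw [hg.eq_prod_roots]
  rw [derivative_C_mul, eval_C_mul, eval_multiset_prod_X_sub_C_derivative hx]

/-- The root `z` of `g` nearest to `w` satisfies `‖g'(z)‖ * ‖w - z‖ ≤ ‖g(w)‖`. -/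
theorem exists_root_norm_derivative_mul_le [NormedField K] [IsUltrametricDist K] {g : K[X]}
    (hg : g.Splits) (hdeg : g.natDegree ≠ 0) (w : K) :
    ∃ z, g.eval z = 0 ∧ ‖(derivative g).eval z‖ * ‖w - z‖ ≤ ‖g.eval w‖ := by
  classical
  have hroots : g.roots ≠ 0 := by
    rw [← Multiset.card_pos, ← hg.natDegree_eq_card_roots]
    exact Nat.pos_of_ne_zero hdeg
  obtain ⟨z, hz, hmin⟩ := Multiset.exists_min_image (fun z => ‖w - z‖) hroots
  refine ⟨z, (mem_roots'.1 hz).2, ?_⟩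
  have hprod : (((g.roots.erase z).map fun x => ‖z - x‖).prod) ≤
      ((g.roots.erase z).map fun x => ‖w - x‖).prod := by
    refine Multiset.prod_map_le_prod_map₀ _ _ (fun _ _ => norm_nonneg _) fun x hx => ?_
    have h := dist_triangle_max z w x
    rw [dist_comm z w] at h
    simp only [dist_eq_norm] at h
    exact h.trans (max_le (hmin x (Multiset.mem_of_mem_erase hx)) le_rfl)
  have hnorm (s : Multiset K) (y : K) : ‖(s.map (y - ·)).prod‖ = (s.map fun x => ‖y - x‖).prod := by
    simpa using map_multiset_prod (normHom : K →*₀ ℝ) (s.map (y - ·))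
  rw [hg.eval_derivative_of_mem_roots hz, hg.eval_eq_prod_roots, norm_mul, norm_mul, hnorm, hnorm,
    ← Multiset.cons_erase hz, Multiset.map_cons, Multiset.prod_cons, Multiset.cons_erase hz,
    mul_assoc, mul_comm _ ‖w - z‖]
  gcongr

/-- Nonconstant polynomials over an algebraically closed normed field are open maps. -/
theorem exists_eval_eq_of_norm_sub_lt [NormedField K] [IsAlgClosed K] {f : K[X]}
    (hdeg : f.natDegree ≠ 0) (y : K) {ε : ℝ} (hε : 0 < ε) :
    ∃ η > 0, ∀ v, ‖f.eval y - v‖ < η → ∃ x, f.eval x = v ∧ ‖y - x‖ < ε := by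
  have hlead : f.leadingCoeff ≠ 0 := leadingCoeff_ne_zero.2 (by rintro rfl; simp at hdeg)
  refine ⟨‖f.leadingCoeff‖ * ε ^ f.natDegree, by positivity, fun v hv => ?_⟩
  by_contra! hfar
  have hsplit := IsAlgClosed.splits (f - C v)
  have hcard : (f - C v).roots.card = f.natDegree := by
    rw [← hsplit.natDegree_eq_card_roots, natDegree_sub_C]
  have hlc : (f - C v).leadingCoeff = f.leadingCoeff := by
    rw [leadingCoeff, natDegree_sub_C, coeff_sub, coeff_C_of_ne_zero hdeg, sub_zero, leadingCoeff]
  have hprod : (((f - C v).roots.map fun _ => ε).prod) ≤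
      ((f - C v).roots.map fun x => ‖y - x‖).prod := by
    refine Multiset.prod_map_le_prod_map₀ _ _ (fun _ _ => hε.le) fun x hx => hfar x ?_
    simpa [sub_eq_zero] using (mem_roots'.1 hx).2
  rw [Multiset.map_const', Multiset.prod_replicate, hcard] at hprod
  have heval : ‖f.eval y - v‖ =
      ‖f.leadingCoeff‖ * ((f - C v).roots.map fun x => ‖y - x‖).prod := by
    have h := hsplit.eval_eq_prod_roots y
    rw [eval_sub, eval_C, hlc] at h
    rw [h, norm_mul]
    congr 1
    simpa using map_multiset_prod (normHom : K →*₀ ℝ) ((f - C v).roots.map (y - ·))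
  rw [heval] at hv
  exact absurd (mul_le_mul_of_nonneg_left hprod (norm_nonneg f.leadingCoeff)) hv.not_ge

/-- The finite part of the Fatou set of a nonconstant polynomial is forward invariant. -/
theorem toP1_eval_mem_fatou [NormedField K] [IsAlgClosed K] {f : K[X]} (hdeg : f.natDegree ≠ 0)
    {z : K} (hz : toP1 z ∈ fatou f) : toP1 (f.eval z) ∈ fatou f := by
  obtain ⟨U, hzU, hU, hequi⟩ := hz
  have hlift (y : K) {ε : ℝ} (hε : 0 < ε) : ∃ η > 0, ∀ v, chordal (toP1 (f.eval y)) v < η →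
      ∃ x, v = toP1 (f.eval x) ∧ chordal (toP1 y) (toP1 x) < ε := by
    obtain ⟨η, hη, h⟩ := exists_eval_eq_of_norm_sub_lt hdeg y hε
    obtain ⟨θ, hθ, h'⟩ := exists_chordal_lt_imp_norm_sub_lt (f.eval y) hη
    refine ⟨θ, hθ, fun v hv => ?_⟩
    obtain ⟨w, rfl, hw⟩ := h' v hv
    obtain ⟨x, rfl, hx⟩ := h w hw
    exact ⟨x, rfl, (chordal_toP1_le_norm_sub _ _).trans_lt hx⟩
  refine ⟨{v | ∃ y, toP1 y ∈ U ∧ v = toP1 (f.eval y)}, ⟨z, hzU, rfl⟩, ?_, ?_⟩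
  · rintro _ ⟨y, hy, rfl⟩
    obtain ⟨ε, hε, hball⟩ := hU _ hy
    obtain ⟨η, hη, h⟩ := hlift y hε
    refine ⟨η, hη, fun v hv => ?_⟩
    obtain ⟨x, rfl, hx⟩ := h v hv
    exact ⟨x, hball _ hx, rfl⟩
  · rintro _ ⟨y, hy, rfl⟩ ε hε
    obtain ⟨γ, hγ, hclose⟩ := hequi _ hy ε hε
    obtain ⟨η, hη, h⟩ := hlift y hγ
    refine ⟨η, hη, fun v hv n => ?_⟩
    obtain ⟨x, rfl, hx⟩ := h v hv
    exact hclose _ hx (n + 1)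

/-- **Proposition 3.5.** Let `f` be immediately expanding with constant `λ > 1`, let
`C(f)` be the set of critical points and critical values of `f`, let `δ > 0` satisfy
`D̄_δ(c) ∩ J(f) = ∅` for all `c ∈ C(f)`, let `μ := min {|k|^{1/(k-1)} : 2 ≤ k ≤ d} · δ`
and `B := ⋃_{z ∈ J(f)} D̄_μ(z)`. Then `B` is backward invariant: `f⁻¹(B) ⊆ B`. -/
theorem backward_invariant_neighborhood_of_julia
    {p : ℕ} [Fact (Nat.Prime p)] {K : Type*} [NormedField K] [IsAlgClosed K]
    [CompleteSpace K] [IsUltrametricDist K] [Algebra ℚ_[p] K]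
    (hext : ∀ q : ℚ_[p], ‖algebraMap ℚ_[p] K q‖ = ‖q‖)
    (d : ℕ) (hd : 2 ≤ d) (f : K[X]) (hdeg : f.natDegree = d)
    (hJ : (julia f).Nonempty)
    (lam : ℝ) (hlam : 1 < lam)
    (hexp : ∀ z : K, toP1 z ∈ julia f → lam ≤ ‖(derivative f).eval z‖)
    (δ : ℝ) (hδ : 0 < δ)
    (hδJ : ∀ c : K,
      (c ∈ {z : K | (derivative f).eval z = 0} ∪
        (fun z => f.eval z) '' {z : K | (derivative f).eval z = 0}) →
      ∀ w ∈ Metric.closedBall c δ, toP1 w ∉ julia f) :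
    (fun w : K => f.eval w) ⁻¹'
        {w : K | ∃ z : K, toP1 z ∈ julia f ∧ w ∈ Metric.closedBall z (muFactor p d * δ)} ⊆
      {w : K | ∃ z : K, toP1 z ∈ julia f ∧ w ∈ Metric.closedBall z (muFactor p d * δ)} := by
  rintro w ⟨ζ, hζ, hw⟩
  obtain ⟨z, hz, hle⟩ := exists_root_norm_derivative_mul_le (IsAlgClosed.splits (f - C ζ))
    (by rw [natDegree_sub_C]; lia) w
  rw [eval_sub, eval_C, sub_eq_zero] at hz
  have hzJ : toP1 z ∈ julia f := fun h => hζ (hz ▸ toP1_eval_mem_fatou (by lia) h)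
  refine ⟨z, hzJ, ?_⟩
  rw [mem_closedBall_iff_norm] at hw ⊢
  refine le_trans ?_ hw
  simp only [derivative_sub, derivative_C, sub_zero, eval_sub, eval_C] at hle
  nlinarith [hexp z hzJ, norm_nonneg (w - z)]
end
end

section
/- Let d ≥ 2, let B ⊆ ℂ_p be non-empty, let M ≥ 1 with B ⊆ D̄_M(0), let 0 < δ ≤ 1 with D̄_δ(z) ⊆ B for all z ∈ B, let λ > 1, and set μ := min{|l|^{1/(l−1)} : l ∈ {2,…,d}} · δ, where |l| is the p-adic absolute value of the integer l. Let g be a polynomial map of degree d over ℂ_p with |g'(z)| ≥ λ for all z ∈ B and g⁻¹(B) ⊆ B. Let i ∈ {0, 1, …, d} and ε ∈ ℂ_p with |ε| < min(λ / M^{i−1}, μ / M^i). Then the perturbed polynomial g_ε(z) := g(z) + ε·z^i satisfies g_ε⁻¹(B) ⊆ B. -/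
open Polynomial

noncomputable section

variable {K : Type*}

theorem norm_prod_map_sub_eq_of_lt {K : Type*} [NormedField K] [IsUltrametricDist K] {M : ℝ}
    {z : K} (hz : M < ‖z‖) (s : Multiset K) (hs : ∀ b ∈ s, ‖b‖ ≤ M) :
    ‖(s.map (fun b => z - b)).prod‖ = ‖z‖ ^ s.card := by
  induction s using Multiset.induction_on with
  | empty => simp
  | cons b s ih =>
    have hb : ‖b‖ < ‖z‖ := (hs b (Multiset.mem_cons_self b s)).trans_lt hz
    have hzb : ‖z - b‖ = ‖z‖ := by
      have h := IsUltrametricDist.norm_add_eq_max_of_norm_ne_norm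
        (x := z) (y := -b) (by rw [norm_neg]; exact hb.ne')
      rw [sub_eq_add_neg, h, norm_neg, max_eq_left hb.le]
    rw [Multiset.map_cons, Multiset.prod_cons, norm_mul, hzb,
      ih fun c hc => hs c (Multiset.mem_cons_of_mem hc), Multiset.card_cons, pow_succ']

theorem norm_prod_map_sub_le {K : Type*} [NormedField K] [IsUltrametricDist K] {M : ℝ}
    {a : K} (ha : ‖a‖ ≤ M) (s : Multiset K) (hs : ∀ b ∈ s, ‖b‖ ≤ M) :
    ‖(s.map (fun b => a - b)).prod‖ ≤ M ^ s.card := by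
  induction s using Multiset.induction_on with
  | empty => simp
  | cons b s ih =>
    have hab : ‖a - b‖ ≤ M :=
      sub_eq_add_neg a b ▸ (IsUltrametricDist.norm_add_le_max a (-b)).trans
        (max_le ha ((norm_neg b).trans_le (hs b (Multiset.mem_cons_self b s))))
    rw [Multiset.map_cons, Multiset.prod_cons, norm_mul, Multiset.card_cons, pow_succ']
    exact mul_le_mul hab (ih fun c hc => hs c (Multiset.mem_cons_of_mem hc)) (norm_nonneg _)
      ((norm_nonneg a).trans ha)

/-- If all roots of a polynomial lie in the disc of radius `M`, then its derivative at a root is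
bounded by `|c| M ^ (d - 1)`, where `c` is the leading coefficient. -/
theorem norm_eval_derivative_mul_le {K : Type*} [NormedField K] [IsAlgClosed K]
    [IsUltrametricDist K] {M : ℝ} (h : K[X]) (hM : ∀ b ∈ h.roots, ‖b‖ ≤ M)
    {a : K} (ha : a ∈ h.roots) :
    ‖(derivative h).eval a‖ * M ≤ ‖h.leadingCoeff‖ * M ^ h.natDegree := by
  obtain ⟨s, hs⟩ := Multiset.exists_cons_of_mem ha
  have hcard : h.natDegree = s.card + 1 := by
    rw [(IsAlgClosed.splits h).natDegree_eq_card_roots, hs, Multiset.card_cons]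
  have hder : (derivative h).eval a = h.leadingCoeff * (s.map (fun b => a - b)).prod := by
    have hh := (IsAlgClosed.splits h).eq_prod_roots
    rw [hs, Multiset.map_cons, Multiset.prod_cons] at hh
    conv_lhs => rw [hh]
    simp [derivative_mul, eval_multiset_prod]
  have hs' := norm_prod_map_sub_le (hM a ha) s
    fun b hb => hM b (hs ▸ Multiset.mem_cons_of_mem hb)
  rw [hder, norm_mul, hcard, pow_succ, ← mul_assoc]
  have h0 : 0 ≤ M := (norm_nonneg a).trans (hM a ha)
  gcongr

theorem norm_eval_eq_of_roots_le {K : Type*} [NormedField K] [IsAlgClosed K]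
    [IsUltrametricDist K] {M : ℝ} (h : K[X]) (hM : ∀ b ∈ h.roots, ‖b‖ ≤ M)
    {z : K} (hz : M < ‖z‖) :
    ‖h.eval z‖ = ‖h.leadingCoeff‖ * ‖z‖ ^ h.natDegree := by
  rw [(IsAlgClosed.splits h).natDegree_eq_card_roots, ← norm_prod_map_sub_eq_of_lt hz _ hM,
    ← norm_mul]
  conv_lhs => rw [(IsAlgClosed.splits h).eq_prod_roots]
  simp [eval_multiset_prod]

/-- **Proposition 3.7.** Under the standing assumptions on `B`, `M`, `δ`, `λ` and
`μ := min {|l|^{1/(l-1)} : 2 ≤ l ≤ d} · δ`, if `g` is expanding on `B` with `g⁻¹(B) ⊆ B`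
and `|ε| < min (λ / M^{i-1}) (μ / M^i)`, then the perturbation `g_ε(z) := g(z) + ε·z^i`
also satisfies `g_ε⁻¹(B) ⊆ B`. -/
theorem perturbation_preserves_backward_invariance
    {p : ℕ} [Fact (Nat.Prime p)] {K : Type*} [NormedField K] [IsAlgClosed K]
    [CompleteSpace K] [IsUltrametricDist K] [Algebra ℚ_[p] K]
    (hext : ∀ q : ℚ_[p], ‖algebraMap ℚ_[p] K q‖ = ‖q‖)
    (d : ℕ) (hd : 2 ≤ d)
    (B : Set K) (hB : B.Nonempty)
    (M : ℝ) (hM : 1 ≤ M) (hBM : B ⊆ Metric.closedBall 0 M)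
    (δ : ℝ) (hδ : 0 < δ) (hδ1 : δ ≤ 1)
    (hthick : ∀ z ∈ B, Metric.closedBall z δ ⊆ B)
    (lam : ℝ) (hlam : 1 < lam)
    (g : K[X]) (hdeg : g.natDegree = d)
    (hexp : ∀ z ∈ B, lam ≤ ‖(derivative g).eval z‖)
    (hinv : (fun z => g.eval z) ⁻¹' B ⊆ B)
    (i : ℕ) (hi : i ≤ d) (ε : K)
    (hε : ‖ε‖ < min (lam / M ^ ((i : ℤ) - 1)) (muFactor p d * δ / M ^ (i : ℤ))) :
    (fun z => (g + C ε * X ^ i).eval z) ⁻¹' B ⊆ B := by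
  intro z hz
  have hM0 : 0 < M := one_pos.trans_le hM
  have hε1 : ‖ε‖ * M ^ i < lam * M := by
    have h := hε.trans_le (min_le_left _ _)
    rw [zpow_sub_one₀ hM0.ne', zpow_natCast, lt_div_iff₀ (by positivity), ← mul_assoc,
      mul_inv_lt_iff₀ hM0] at h
    exact h
  have hε2 : ‖ε‖ * M ^ i ≤ δ := by
    have h := hε.trans_le (min_le_right _ _)
    rw [zpow_natCast, lt_div_iff₀ (by positivity)] at h
    exact h.le.trans (mul_le_of_le_one_left hδ.le (muFactor_le_one p hd))
  set w := (g + C ε * X ^ i).eval z with hw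
  replace hz : w ∈ B := hz
  have hgw : g.eval z - w = -(ε * z ^ i) := by simp [hw]
  rcases le_or_gt ‖z‖ M with hzM | hzM
  · refine hinv (hthick w hz ?_)
    rw [mem_closedBall_iff_norm, hgw, norm_neg, norm_mul, norm_pow]
    exact le_trans (by gcongr) hε2
  exfalso
  set h := g - C w with hh
  have hdegh : h.natDegree = d := by rw [hh, natDegree_sub_C, hdeg]
  have hrootB : ∀ b ∈ h.roots, b ∈ B := fun b hb => by
    have hb0 : g.eval b = w := by
      have := isRoot_of_mem_roots hb
      simpa [hh, sub_eq_zero] using this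
    exact hinv (show g.eval b ∈ B from hb0 ▸ hz)
  have hroot : ∀ b ∈ h.roots, ‖b‖ ≤ M := fun b hb => by
    simpa using hBM (hrootB b hb)
  obtain ⟨a, ha⟩ : ∃ a, a ∈ h.roots := by
    apply Multiset.card_pos_iff_exists_mem.mp
    rw [← (IsAlgClosed.splits h).natDegree_eq_card_roots]
    omega
  have hlow : lam * M ≤ ‖h.leadingCoeff‖ * M ^ d := by
    have h1 := norm_eval_derivative_mul_le h hroot ha
    have h2 : lam ≤ ‖(derivative h).eval a‖ := by simpa [hh] using hexp a (hrootB a ha)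
    rw [hdegh] at h1
    exact le_trans (by gcongr) h1
  have heq : ‖h.leadingCoeff‖ * ‖z‖ ^ d = ‖ε‖ * ‖z‖ ^ i := by
    rw [← hdegh, ← norm_eval_eq_of_roots_le h hroot hzM, hh, eval_sub, eval_C, hgw, norm_neg,
      norm_mul, norm_pow]
  obtain ⟨k, rfl⟩ := Nat.exists_eq_add_of_le hi
  have hzpos : 0 < ‖z‖ ^ i := pow_pos (hM0.trans hzM) i
  have heq' : ‖h.leadingCoeff‖ * ‖z‖ ^ k = ‖ε‖ := by
    apply mul_right_cancel₀ hzpos.ne'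
    rw [← heq, pow_add]
    ring
  have hle : ‖h.leadingCoeff‖ * M ^ (i + k) ≤ ‖ε‖ * M ^ i := by
    rw [← heq', pow_add, mul_comm (M ^ i), ← mul_assoc]
    gcongr
  linarith
end
end

section
/- Let p be an odd prime number and let F be the polynomial map over ℂ_p defined by F(z) := z(z − 1)/p. Then the Julia set J(F) is non-empty, and there exists a homeomorphism h : J(F) → Σ such that h(F(z)) = σ(h(z)) for all z ∈ J(F), where Σ is the two-symbol sequence space and σ the shift map. In particular, J(F) is compact. -/
open Polynomial

noncomputable section

variable {K : Type*}

/-- The shift map on the two-symbol sequence space `Σ = {0,1}^ℕ`. -/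
def shiftMap : (ℕ → Bool) → (ℕ → Bool) := fun s n => s (n + 1)

namespace QuadraticShift

/-- The quadratic map `z ↦ (z² - z) / c`. -/
def quad [Field K] (c z : K) : K := c⁻¹ * (z ^ 2 - z)

/-- The centre of the residue disc labelled by a symbol: `0` for `false` and `1` for `true`. -/
def center (K : Type*) [Field K] (b : Bool) : K := bif b then 1 else 0

/-- The neighbourhood of `∞` on which `quad c` escapes. -/
def escapeNhd [NormedField K] : Set (P1 K) := {x | ∀ z : K, x = toP1 z → 1 < ‖z‖}

lemma toP1_injective : Function.Injective (toP1 : K → P1 K) := Option.some_injective K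

lemma infty_ne_toP1 (z : K) : P1.infty ≠ toP1 z := (Option.some_ne_none z).symm

lemma eq_infty_or_eq_toP1 (x : P1 K) : x = P1.infty ∨ ∃ z, x = toP1 z := by
  rcases x with _ | z
  exacts [Or.inl rfl, Or.inr ⟨z, rfl⟩]

lemma polyMap_toP1 [Field K] (c z : K) :
    polyMap (C c⁻¹ * (X ^ 2 - X)) (toP1 z) = (toP1 (quad c z)) := by
  change toP1 (eval z _) = _
  simp [quad]

lemma polyMap_iterate_toP1 [Field K] (c z : K) (n : ℕ) :
    (polyMap (C c⁻¹ * (X ^ 2 - X)))^[n] (toP1 z) = (toP1 ((quad c)^[n] z)) := by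
  induction n generalizing z with
  | zero => rfl
  | succ n ih => rw [Function.iterate_succ_apply, polyMap_toP1, ih, Function.iterate_succ_apply]

lemma continuous_quad [NormedField K] (c : K) : Continuous (quad c) := by
  unfold quad
  fun_prop

section Chordal

variable [NormedField K]

lemma chordal_toP1_toP1 (z w : K) :
    chordal (toP1 z) (toP1 w) = ‖z - w‖ / (max ‖z‖ 1 * max ‖w‖ 1) := rfl

lemma chordal_toP1_infty (z : K) :
    chordal (toP1 z) P1.infty = 1 / max ‖z‖ 1 := rfl

lemma chordal_infty_toP1 (z : K) :
    chordal (P1.infty : P1 K) (toP1 z) = 1 / max ‖z‖ 1 := rfl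

lemma chordal_toP1_toP1_le (z w : K) :
    chordal (toP1 z) (toP1 w) ≤ ‖z - w‖ := by
  rw [chordal_toP1_toP1]
  apply div_le_self (norm_nonneg _)
  nlinarith [le_max_right ‖z‖ 1, le_max_right ‖w‖ 1]

variable [IsUltrametricDist K]

lemma norm_sub_eq_of_lt {z w : K} (h : ‖z‖ < ‖w‖) : ‖z - w‖ = ‖w‖ := by
  rw [sub_eq_add_neg, IsUltrametricDist.norm_add_eq_max_of_norm_ne_norm (by simpa using h.ne),
    norm_neg, max_eq_right h.le]

lemma norm_sub_le_max (z w : K) : ‖z - w‖ ≤ max ‖z‖ ‖w‖ := by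
  simpa [sub_eq_add_neg] using IsUltrametricDist.norm_add_le_max z (-w)

lemma exists_of_chordal_toP1_lt (z : K) {y : P1 K} {δ : ℝ}
    (hδ : δ ≤ 1 / max ‖z‖ 1) (h : chordal (toP1 z) y < δ) :
    ∃ w : K, y = toP1 w ∧ ‖z - w‖ < δ * (max ‖z‖ 1) ^ 2 := by
  have hM : 1 ≤ max ‖z‖ 1 := le_max_right _ _
  rcases eq_infty_or_eq_toP1 y with rfl | ⟨w, rfl⟩
  · exact absurd (h.trans_le hδ) (by rw [chordal_toP1_infty]; exact lt_irrefl _)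
  · refine ⟨w, rfl, ?_⟩
    rw [chordal_toP1_toP1] at h
    rcases lt_or_ge (max ‖z‖ 1) ‖w‖ with hw | hw
    · exfalso
      have hzw : ‖z‖ < ‖w‖ := (le_max_left _ _).trans_lt hw
      rw [norm_sub_eq_of_lt hzw, max_eq_left (hM.trans hw.le)] at h
      have := h.trans_le hδ
      rw [div_lt_div_iff₀ (by nlinarith) (by linarith)] at this
      nlinarith
    · have hw' : max ‖w‖ 1 ≤ max ‖z‖ 1 := max_le hw hM
      have hw1 : 1 ≤ max ‖w‖ 1 := le_max_right _ _
      rw [div_lt_iff₀ (by positivity)] at h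
      have hδ0 : 0 < δ := by
        by_contra! hneg
        have : δ * (max ‖z‖ 1 * max ‖w‖ 1) ≤ 0 :=
          mul_nonpos_of_nonpos_of_nonneg hneg (by positivity)
        linarith [norm_nonneg (z - w)]
      refine h.trans_le ?_
      rw [sq]
      gcongr

lemma exists_of_chordal_unit_lt {z : K} (hz : ‖z‖ ≤ 1) {y : P1 K} {δ : ℝ}
    (hδ : δ ≤ 1) (h : chordal (toP1 z) y < δ) : ∃ w : K, y = toP1 w ∧ ‖z - w‖ < δ := by
  have := exists_of_chordal_toP1_lt z (by simpa [max_eq_right hz] using hδ) h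
  simpa [max_eq_right hz] using this

lemma isOpen_ball_image {x : K} (hx : ‖x‖ ≤ 1) {r : ℝ} (hr : 0 < r) (hr1 : r ≤ 1) :
    IsOpen {y : P1 K | ∃ w : K, y = toP1 w ∧ ‖x - w‖ < r} := by
  rintro _ ⟨z, rfl, hz⟩
  refine ⟨r, hr, fun y hy => ?_⟩
  have hz1 : ‖z‖ ≤ 1 := by
    have : z = x - (x - z) := by ring
    rw [this]
    exact (norm_sub_le_max _ _).trans (max_le hx (hz.le.trans hr1))
  obtain ⟨w, rfl, hw⟩ := exists_of_chordal_unit_lt hz1 hr1 hy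
  refine ⟨w, rfl, ?_⟩
  have : x - w = (x - z) + (z - w) := by ring
  rw [this]
  exact (IsUltrametricDist.norm_add_le_max _ _).trans_lt (max_lt hz hw)

lemma t2Space_of_subset_unit {S : Set (P1 K)}
    (hS : ∀ x ∈ S, ∃ z : K, x = toP1 z ∧ ‖z‖ ≤ 1) : T2Space S := by
  refine ⟨?_⟩
  rintro ⟨x, hx⟩ ⟨y, hy⟩ hxy
  obtain ⟨z, rfl, hz⟩ := hS x hx
  obtain ⟨w, rfl, hw⟩ := hS y hy
  have hne : z ≠ w := fun h => hxy (by subst h; rfl)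
  have hr : 0 < ‖z - w‖ := norm_pos_iff.2 (sub_ne_zero.2 hne)
  have hr1 : ‖z - w‖ ≤ 1 := (norm_sub_le_max _ _).trans (max_le hz hw)
  refine ⟨_, _, (isOpen_ball_image hz hr hr1).preimage continuous_subtype_val,
    (isOpen_ball_image hw hr hr1).preimage continuous_subtype_val,
    ⟨z, rfl, by simpa using hr⟩, ⟨w, rfl, by simpa using hr⟩, ?_⟩
  rw [Set.disjoint_left]
  rintro ⟨_, _⟩ ⟨u, rfl, hu⟩ ⟨v, hv, hv'⟩
  obtain rfl : u = v := toP1_injective hv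
  have : z - w = (z - u) - (w - u) := by ring
  have h := norm_sub_le_max (z - u) (w - u)
  rw [← this] at h
  exact absurd h (not_le.2 (max_lt hu hv'))

lemma mem_escapeNhd_of_chordal_lt {x y : P1 K} (hx : x ∈ escapeNhd) (h : chordal x y < 1) :
    y ∈ escapeNhd := by
  rintro w rfl
  by_contra! hw
  rcases eq_infty_or_eq_toP1 x with rfl | ⟨z, rfl⟩
  · simp [chordal_infty_toP1, max_eq_right hw] at h
  · have hz : 1 < ‖z‖ := hx z rfl
    rw [chordal_toP1_toP1, norm_sub_rev, norm_sub_eq_of_lt (hw.trans_lt hz), max_eq_right hw,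
      max_eq_left hz.le, mul_one, div_self (by positivity)] at h
    exact lt_irrefl _ h

end Chordal

lemma continuous_toP1 [NormedField K] : Continuous (toP1 : K → P1 K) := by
  refine ⟨fun U hU => Metric.isOpen_iff.2 fun x hx => ?_⟩
  obtain ⟨ε, hε, h⟩ := hU _ hx
  refine ⟨ε, hε, fun y hy => h _ ((chordal_toP1_toP1_le x y).trans_lt ?_)⟩
  rwa [← dist_eq_norm, dist_comm]

lemma norm_quad [NormedField K] (c z : K) : ‖quad c z‖ = ‖c‖⁻¹ * (‖z‖ * ‖z - 1‖) := by
  rw [quad, norm_mul, norm_inv, ← norm_mul z]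
  congr 3
  ring

lemma norm_quad_sub [NormedField K] (c z w : K) : ‖quad c z - quad c w‖ = ‖c‖⁻¹ * (‖z - w‖ * ‖z + w - 1‖) := by
  rw [← norm_mul, ← norm_inv, ← norm_mul]
  congr 1
  simp only [quad]
  ring

section Dynamics

variable [NormedField K] {c : K}

lemma exists_center (hc0 : 0 < ‖c‖) (hc1 : ‖c‖ < 1) {z : K} (h : ‖quad c z‖ ≤ 1) :
    ∃ b, ‖z - center K b‖ < 1 := by
  by_contra! hb
  have h0 : 1 ≤ ‖z‖ := by simpa [center] using hb false
  have h1 : 1 ≤ ‖z - 1‖ := by simpa [center] using hb true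
  rw [norm_quad] at h
  have := one_lt_inv₀ hc0 |>.2 hc1
  nlinarith [mul_le_mul h0 h1 zero_le_one (norm_nonneg z)]

/-- The first `n` points of the orbit of `z` lie in the residue discs prescribed by `s`. -/
def Follows (c : K) (s : ℕ → Bool) (n : ℕ) (z : K) : Prop :=
  ∀ k < n, ‖(quad c)^[k] z - center K (s k)‖ < 1

lemma Follows.quad {s : ℕ → Bool} {n : ℕ} {z : K} (h : Follows c s (n + 1) z) :
    Follows c (shiftMap s) n (quad c z) := fun k hk => by
  simpa only [Function.iterate_succ_apply, shiftMap] using h (k + 1) (by lia)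

lemma exists_itinerary (hc0 : 0 < ‖c‖) (hc1 : ‖c‖ < 1) {z : K}
    (h : ∀ n, ‖(quad c)^[n] z‖ ≤ 1) : ∃ s : ℕ → Bool, ∀ n, Follows c s n z := by
  choose s hs using fun n => exists_center hc0 hc1 (z := (quad c)^[n] z)
    (by simpa only [Function.iterate_succ_apply'] using h (n + 1))
  exact ⟨s, fun _ k _ => hs k⟩

lemma exists_quad_eq [IsAlgClosed K] (hc0 : 0 < ‖c‖) (hc1 : ‖c‖ < 1) {y : K} (hy : ‖y‖ ≤ 1)
    (b : Bool) : ∃ x, quad c x = y ∧ ‖x - center K b‖ < 1 := by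
  have hc : c ≠ 0 := norm_pos_iff.1 hc0
  obtain ⟨x, hx⟩ : ∃ x, quad c x = y := by
    obtain ⟨x, hx⟩ := IsAlgClosed.exists_root (X ^ 2 - X - C (c * y)) (by
      have : (X ^ 2 - X - C (c * y) : K[X]).degree = 2 := by compute_degree!
      rw [this]; decide)
    refine ⟨x, ?_⟩
    simp only [IsRoot.def, eval_sub, eval_pow, eval_X, eval_C] at hx
    rw [quad, sub_eq_zero.1 hx, inv_mul_cancel_left₀ hc]
  obtain ⟨a, ha⟩ := exists_center hc0 hc1 (hx ▸ hy : ‖quad c x‖ ≤ 1)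
  by_cases hab : a = b
  · exact ⟨x, hx, hab ▸ ha⟩
  · refine ⟨1 - x, ?_, ?_⟩
    · rw [← hx, quad, quad]; ring
    · have : 1 - x - center K b = -(x - center K a) := by
        cases a <;> cases b <;> simp_all [center]
      rwa [this, norm_neg]

variable [IsUltrametricDist K]

lemma norm_sub_one_of_one_lt {z : K} (hz : 1 < ‖z‖) : ‖z - 1‖ = ‖z‖ := by
  rw [norm_sub_rev, norm_sub_eq_of_lt (by simpa using hz)]

lemma norm_quad_of_one_lt {z : K} (hz : 1 < ‖z‖) : ‖quad c z‖ = ‖c‖⁻¹ * ‖z‖ ^ 2 := by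
  rw [norm_quad, norm_sub_one_of_one_lt hz, sq]

lemma norm_le_norm_quad (hc0 : 0 < ‖c‖) (hc1 : ‖c‖ < 1) {z : K} (hz : 1 < ‖z‖) :
    ‖z‖ ≤ ‖quad c z‖ := by
  rw [norm_quad_of_one_lt hz]
  have := one_lt_inv₀ hc0 |>.2 hc1
  nlinarith

lemma polyMap_mem_escapeNhd (hc0 : 0 < ‖c‖) (hc1 : ‖c‖ < 1) {x : P1 K} (hx : x ∈ escapeNhd) :
    polyMap (C c⁻¹ * (X ^ 2 - X)) x ∈ escapeNhd := by
  rcases eq_infty_or_eq_toP1 x with rfl | ⟨z, rfl⟩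
  · intro z hz
    exact absurd hz (infty_ne_toP1 z)
  · intro w hw
    have h := (polyMap_toP1 c z).symm.trans hw
    obtain rfl : quad c z = w := toP1_injective h
    exact (hx z rfl).trans_le (norm_le_norm_quad hc0 hc1 (hx z rfl))

lemma chordal_polyMap_le (hc0 : 0 < ‖c‖) (hc1 : ‖c‖ < 1) {x y : P1 K}
    (hx : x ∈ escapeNhd) (hy : y ∈ escapeNhd) :
    chordal (polyMap (C c⁻¹ * (X ^ 2 - X)) x) (polyMap (C c⁻¹ * (X ^ 2 - X)) y)
      ≤ chordal x y := by
  have key : ∀ z : K, 1 < ‖z‖ → 1 / max ‖quad c z‖ 1 ≤ 1 / max ‖z‖ 1 := fun z hz =>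
    one_div_le_one_div_of_le (by positivity)
      (max_le_max (norm_le_norm_quad hc0 hc1 hz) le_rfl)
  rcases eq_infty_or_eq_toP1 x with rfl | ⟨z, rfl⟩ <;>
    rcases eq_infty_or_eq_toP1 y with rfl | ⟨w, rfl⟩
  · exact le_rfl
  · rw [polyMap_toP1]
    exact key w (hy w rfl)
  · rw [polyMap_toP1]
    exact key z (hx z rfl)
  · have hz : 1 < ‖z‖ := hx z rfl
    have hw : 1 < ‖w‖ := hy w rfl
    rw [polyMap_toP1, polyMap_toP1, chordal_toP1_toP1, chordal_toP1_toP1,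
      max_eq_left (hz.le.trans (norm_le_norm_quad hc0 hc1 hz)),
      max_eq_left (hw.le.trans (norm_le_norm_quad hc0 hc1 hw)), max_eq_left hz.le,
      max_eq_left hw.le, norm_quad_sub, norm_quad_of_one_lt hz, norm_quad_of_one_lt hw]
    have hs : ‖z + w - 1‖ ≤ ‖z‖ * ‖w‖ := by
      refine (norm_sub_le_max _ _).trans (max_le
        ((IsUltrametricDist.norm_add_le_max _ _).trans (max_le ?_ ?_)) ?_)
      · nlinarith
      · nlinarith
      · rw [norm_one]; nlinarith
    have hi : 1 ≤ ‖c‖⁻¹ := (one_lt_inv₀ hc0 |>.2 hc1).le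
    rw [div_le_div_iff₀ (by positivity) (by positivity)]
    calc ‖c‖⁻¹ * (‖z - w‖ * ‖z + w - 1‖) * (‖z‖ * ‖w‖)
        ≤ ‖c‖⁻¹ * (‖z - w‖ * (‖z‖ * ‖w‖)) * (‖z‖ * ‖w‖) := by gcongr
      _ = 1 * (‖c‖⁻¹ * (‖z - w‖ * (‖z‖ * ‖w‖)) * (‖z‖ * ‖w‖)) := by ring
      _ ≤ ‖c‖⁻¹ * (‖c‖⁻¹ * (‖z - w‖ * (‖z‖ * ‖w‖)) * (‖z‖ * ‖w‖)) := by gcongr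
      _ = ‖z - w‖ * (‖c‖⁻¹ * ‖z‖ ^ 2 * (‖c‖⁻¹ * ‖w‖ ^ 2)) := by ring

/-- Equicontinuity of the iterates of a self-map of the projective line at a point. -/
def EquicontAt (T : P1 K → P1 K) (x : P1 K) : Prop :=
  ∀ ε > 0, ∃ δ > 0, ∀ z : P1 K, chordal x z < δ →
    ∀ n : ℕ, chordal (T^[n] x) (T^[n] z) < ε

lemma chordal_iterate_le (hc0 : 0 < ‖c‖) (hc1 : ‖c‖ < 1) {x y : P1 K}
    (hx : x ∈ escapeNhd) (hy : y ∈ escapeNhd) (n : ℕ) :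
    chordal ((polyMap (C c⁻¹ * (X ^ 2 - X)))^[n] x) ((polyMap (C c⁻¹ * (X ^ 2 - X)))^[n] y)
      ≤ chordal x y := by
  induction n generalizing x y with
  | zero => exact le_rfl
  | succ n ih =>
    rw [Function.iterate_succ_apply, Function.iterate_succ_apply]
    exact (ih (polyMap_mem_escapeNhd hc0 hc1 hx) (polyMap_mem_escapeNhd hc0 hc1 hy)).trans
      (chordal_polyMap_le hc0 hc1 hx hy)

lemma equicontAt_of_mem_escapeNhd (hc0 : 0 < ‖c‖) (hc1 : ‖c‖ < 1) {x : P1 K}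
    (hx : x ∈ escapeNhd) : EquicontAt (polyMap (C c⁻¹ * (X ^ 2 - X))) x := fun ε hε =>
  ⟨min ε 1, lt_min hε one_pos, fun _ hz n =>
    (chordal_iterate_le hc0 hc1 hx
      (mem_escapeNhd_of_chordal_lt hx (hz.trans_le (min_le_right _ _))) n).trans_lt
      (hz.trans_le (min_le_left _ _))⟩

lemma polyMap_chordal_continuous_toP1 (z : K) {ε : ℝ} (hε : 0 < ε) :
    ∃ δ > 0, ∀ y : P1 K, chordal (toP1 z) y < δ →
      chordal (polyMap (C c⁻¹ * (X ^ 2 - X)) (toP1 z))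
        (polyMap (C c⁻¹ * (X ^ 2 - X)) y) < ε := by
  obtain ⟨η, hη, h⟩ := Metric.continuous_iff.1 (continuous_quad c) z ε hε
  refine ⟨min (1 / max ‖z‖ 1) (η / (max ‖z‖ 1) ^ 2), by positivity, fun y hy => ?_⟩
  obtain ⟨w, rfl, hw⟩ := exists_of_chordal_toP1_lt z (min_le_left _ _) hy
  have hw' : ‖z - w‖ < η := by
    refine hw.trans_le ?_
    rw [← le_div_iff₀ (by positivity)]
    exact min_le_right _ _
  rw [polyMap_toP1, polyMap_toP1]
  refine (chordal_toP1_toP1_le _ _).trans_lt ?_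
  rw [← dist_eq_norm, dist_comm]
  apply h
  rwa [dist_comm, dist_eq_norm]

lemma equicontAt_of_polyMap {z : K}
    (h : EquicontAt (polyMap (C c⁻¹ * (X ^ 2 - X)))
      (polyMap (C c⁻¹ * (X ^ 2 - X)) (toP1 z))) :
    EquicontAt (polyMap (C c⁻¹ * (X ^ 2 - X))) (toP1 z) := by
  intro ε hε
  obtain ⟨δ₁, hδ₁, h₁⟩ := h ε hε
  obtain ⟨δ₂, hδ₂, h₂⟩ := polyMap_chordal_continuous_toP1 (c := c) z hδ₁
  refine ⟨min δ₂ ε, lt_min hδ₂ hε, fun y hy n => ?_⟩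
  cases n with
  | zero => exact hy.trans_le (min_le_right _ _)
  | succ n =>
    rw [Function.iterate_succ_apply, Function.iterate_succ_apply]
    exact h₁ _ (h₂ y (hy.trans_le (min_le_left _ _))) n

lemma equicontAt_of_iterate_mem (hc0 : 0 < ‖c‖) (hc1 : ‖c‖ < 1) {x : P1 K} {n : ℕ}
    (hx : (polyMap (C c⁻¹ * (X ^ 2 - X)))^[n] x ∈ escapeNhd) :
    EquicontAt (polyMap (C c⁻¹ * (X ^ 2 - X))) x := by
  induction n generalizing x with
  | zero => exact equicontAt_of_mem_escapeNhd hc0 hc1 hx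
  | succ n ih =>
    rw [Function.iterate_succ_apply] at hx
    rcases eq_infty_or_eq_toP1 x with rfl | ⟨z, rfl⟩
    · exact equicontAt_of_mem_escapeNhd hc0 hc1 (fun z hz => absurd hz (infty_ne_toP1 z))
    · exact equicontAt_of_polyMap (ih hx)

lemma mem_fatou_of_iterate_mem (hc0 : 0 < ‖c‖) (hc1 : ‖c‖ < 1) {x : P1 K} {n : ℕ}
    (hx : (polyMap (C c⁻¹ * (X ^ 2 - X)))^[n] x ∈ escapeNhd) :
    x ∈ fatou (C c⁻¹ * (X ^ 2 - X)) := by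
  refine ⟨{y | ∃ n, (polyMap (C c⁻¹ * (X ^ 2 - X)))^[n] y ∈ escapeNhd}, ⟨n, hx⟩, ?_, ?_⟩
  · rintro y ⟨m, hm⟩
    obtain ⟨δ, hδ, h⟩ := equicontAt_of_iterate_mem hc0 hc1 hm 1 one_pos
    exact ⟨δ, hδ, fun z hz => ⟨m, mem_escapeNhd_of_chordal_lt hm (h z hz m)⟩⟩
  · rintro y ⟨m, hm⟩
    exact equicontAt_of_iterate_mem hc0 hc1 hm

lemma norm_le_one_of_sub_center {z : K} {b : Bool} (h : ‖z - center K b‖ < 1) : ‖z‖ ≤ 1 := by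
  have hb : ‖center K b‖ ≤ 1 := by cases b <;> simp [center]
  calc ‖z‖ = ‖(z - center K b) + center K b‖ := by rw [sub_add_cancel]
    _ ≤ _ := (IsUltrametricDist.norm_add_le_max _ _).trans (max_le h.le hb)

lemma center_injective {z : K} {a b : Bool} (ha : ‖z - center K a‖ < 1)
    (hb : ‖z - center K b‖ < 1) : a = b := by
  by_contra hab
  have h1 : ‖center K b - center K a‖ = 1 := by
    cases a <;> cases b <;> simp_all [center]
  have h2 : center K b - center K a = (z - center K a) - (z - center K b) := by ring
  rw [h2] at h1
  exact absurd ((norm_sub_le_max _ _).trans_lt (max_lt ha hb)) h1.not_lt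

lemma norm_quad_sub_of_center {z w : K} {b : Bool} (hz : ‖z - center K b‖ < 1)
    (hw : ‖w - center K b‖ < 1) : ‖quad c z - quad c w‖ = ‖c‖⁻¹ * ‖z - w‖ := by
  rw [norm_quad_sub]
  have hlt : ‖(z - center K b) + (w - center K b)‖ < 1 :=
    (IsUltrametricDist.norm_add_le_max _ _).trans_lt (max_lt hz hw)
  have h1 : ‖1 - 2 * center K b‖ = 1 := by
    cases b
    · simp [center]
    · simp only [center, cond_true]
      rw [show (1 : K) - 2 * 1 = -1 by ring, norm_neg, norm_one]
  have : z + w - 1 = (z - center K b) + (w - center K b) - (1 - 2 * center K b) := by ring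
  rw [this, norm_sub_eq_of_lt (hlt.trans_eq h1.symm), h1, mul_one]

lemma Follows.norm_sub_le (hc0 : 0 < ‖c‖) {s : ℕ → Bool} {n : ℕ} {z w : K}
    (hz : Follows c s (n + 1) z) (hw : Follows c s (n + 1) w) : ‖z - w‖ ≤ ‖c‖ ^ n := by
  induction n generalizing s z w with
  | zero =>
    have : z - w = (z - center K (s 0)) - (w - center K (s 0)) := by ring
    rw [this, pow_zero]
    exact (norm_sub_le_max _ _).trans
      (max_le (hz 0 one_pos).le (hw 0 one_pos).le)
  | succ n ih =>
    have h := ih hz.quad hw.quad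
    rw [norm_quad_sub_of_center (z := z) (w := w) (hz 0 (by lia)) (hw 0 (by lia)), inv_mul_le_iff₀ hc0] at h
    rwa [pow_succ']

lemma eq_of_follows (hc0 : 0 < ‖c‖) (hc1 : ‖c‖ < 1) {s : ℕ → Bool} {z w : K}
    (hz : ∀ n, Follows c s n z) (hw : ∀ n, Follows c s n w) : z = w := by
  have h : ‖z - w‖ ≤ 0 := ge_of_tendsto' (tendsto_pow_atTop_nhds_zero_of_lt_one hc0.le hc1)
    fun n => (hz (n + 1)).norm_sub_le hc0 (hw (n + 1))
  exact sub_eq_zero.1 (norm_le_zero_iff.1 h)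

lemma exists_follows [IsAlgClosed K] (hc0 : 0 < ‖c‖) (hc1 : ‖c‖ < 1) (s : ℕ → Bool) (n : ℕ) :
    ∃ z, ‖z‖ ≤ 1 ∧ Follows c s n z := by
  induction n generalizing s with
  | zero => exact ⟨0, by simp, fun k hk => by lia⟩
  | succ n ih =>
    obtain ⟨y, hy, hf⟩ := ih (shiftMap s)
    obtain ⟨x, rfl, hx⟩ := exists_quad_eq hc0 hc1 hy (s 0)
    refine ⟨x, norm_le_one_of_sub_center hx, fun k hk => ?_⟩
    cases k with
    | zero => exact hx
    | succ k => simpa only [Function.iterate_succ_apply, shiftMap] using hf k (by lia)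

lemma exists_forall_follows [IsAlgClosed K] [CompleteSpace K] (hc0 : 0 < ‖c‖) (hc1 : ‖c‖ < 1)
    (s : ℕ → Bool) : ∃ z, ∀ n, Follows c s n z := by
  choose x _ hx using fun n => exists_follows hc0 hc1 s (n + 1)
  have hmono : ∀ {m n : ℕ}, m ≤ n → Follows c s m (x n) := fun hmn k hk => hx _ k (by lia)
  have hcauchy : CauchySeq x := by
    refine cauchySeq_of_le_tendsto_0' (fun n => ‖c‖ ^ n) (fun n m hnm => ?_)
      (tendsto_pow_atTop_nhds_zero_of_lt_one hc0.le hc1)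
    rw [dist_eq_norm]
    exact (hx n).norm_sub_le hc0 fun k hk => hx m k (by lia)
  obtain ⟨z, hz⟩ := cauchySeq_tendsto_of_complete hcauchy
  refine ⟨z, fun _ k _ => ?_⟩
  have hlim := (((continuous_quad c).iterate k).tendsto z).comp hz
  have hmem := (IsUltrametricDist.isClosed_ball (center K (s k)) 1).mem_of_tendsto hlim
    (Filter.eventually_atTop.2 ⟨k + 1, fun n hn => by
      rw [Metric.mem_ball, dist_eq_norm]
      exact hmono hn k (by lia)⟩)
  rwa [Metric.mem_ball, dist_eq_norm] at hmem

lemma toP1_mem_julia (hc0 : 0 < ‖c‖) (hc1 : ‖c‖ < 1) {z : K}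
    (h : ∀ n, ‖(quad c)^[n] z‖ ≤ 1) : (toP1 z) ∈ julia (C c⁻¹ * (X ^ 2 - X)) := by
  rintro ⟨U, hzU, _, hU⟩
  obtain ⟨δ, hδ, hd⟩ := hU _ hzU 1 one_pos
  obtain ⟨m, hm⟩ := exists_pow_lt_of_lt_one hδ hc1
  have hd' := hd (toP1 (z + c ^ m)) ((chordal_toP1_toP1_le _ _).trans_lt (by
    simpa using hm))
  obtain ⟨s, hs⟩ := exists_itinerary hc0 hc1 h
  have heq : z = z + c ^ m := by
    refine eq_of_follows hc0 hc1 hs fun n k hk => ?_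
    have hk' := hd' k
    rw [polyMap_iterate_toP1, polyMap_iterate_toP1] at hk'
    obtain ⟨w, hw, hlt⟩ := exists_of_chordal_unit_lt (h k) le_rfl hk'
    rw [← toP1_injective hw] at hlt
    have : (quad c)^[k] (z + c ^ m) - center K (s k) =
      ((quad c)^[k] z - center K (s k)) - ((quad c)^[k] z - (quad c)^[k] (z + c ^ m)) := by ring
    rw [this]
    exact (norm_sub_le_max _ _).trans_lt (max_lt (hs n k hk) hlt)
  exact pow_ne_zero m (norm_pos_iff.1 hc0) (left_eq_add.1 heq)

lemma mem_julia_iff (hc0 : 0 < ‖c‖) (hc1 : ‖c‖ < 1) {x : P1 K} :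
    x ∈ julia (C c⁻¹ * (X ^ 2 - X)) ↔
      ∃ z : K, x = toP1 z ∧ ∀ n, ‖(quad c)^[n] z‖ ≤ 1 := by
  refine ⟨fun hx => ?_, ?_⟩
  · have hesc := fun n (h : (polyMap (C c⁻¹ * (X ^ 2 - X)))^[n] x ∈ escapeNhd) =>
      hx (mem_fatou_of_iterate_mem hc0 hc1 h)
    rcases eq_infty_or_eq_toP1 x with rfl | ⟨z, rfl⟩
    · exact absurd (fun z hz => absurd hz (infty_ne_toP1 z)) (hesc 0)
    · refine ⟨z, rfl, fun n => ?_⟩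
      by_contra! hn
      refine hesc n fun w hw => ?_
      have h := (polyMap_iterate_toP1 c z n).symm.trans hw
      rwa [← toP1_injective h]
  · rintro ⟨z, rfl, hz⟩
    exact toP1_mem_julia hc0 hc1 hz

lemma norm_iterate_le_one {s : ℕ → Bool} {z : K} (hz : ∀ n, Follows c s n z) (n : ℕ) :
    ‖(quad c)^[n] z‖ ≤ 1 :=
  norm_le_one_of_sub_center (hz (n + 1) n n.lt_succ_self)

theorem exists_homeomorph_julia [IsAlgClosed K] [CompleteSpace K]
    (hc0 : 0 < ‖c‖) (hc1 : ‖c‖ < 1) :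
    ∃ h : (julia (C c⁻¹ * (X ^ 2 - X))) ≃ₜ (ℕ → Bool),
      ∀ (z : P1 K) (hz : z ∈ julia (C c⁻¹ * (X ^ 2 - X))),
        ∃ hfz : polyMap (C c⁻¹ * (X ^ 2 - X)) z ∈ julia (C c⁻¹ * (X ^ 2 - X)),
          h ⟨polyMap (C c⁻¹ * (X ^ 2 - X)) z, hfz⟩ = shiftMap (h ⟨z, hz⟩) := by
  choose Z hZ using exists_forall_follows (K := K) hc0 hc1
  have hmem : ∀ s, (toP1 (Z s) : P1 K) ∈ julia (C c⁻¹ * (X ^ 2 - X)) := fun s =>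
    toP1_mem_julia hc0 hc1 (norm_iterate_le_one (hZ s))
  have hcont : Continuous Z := by
    refine continuous_iff_continuousAt.2 fun s => Metric.tendsto_nhds.2 fun ε hε => ?_
    obtain ⟨m, hm⟩ := exists_pow_lt_of_lt_one hε hc1
    have hev : ∀ᶠ t in nhds s, ∀ k ∈ Finset.range (m + 1), t k = s k := by
      rw [Filter.eventually_all_finset]
      intro k _
      exact (continuous_apply k).continuousAt.eventually_mem
        ((isOpen_discrete {s k}).mem_nhds rfl)
    filter_upwards [hev] with t ht
    rw [dist_eq_norm]
    refine lt_of_le_of_lt (Follows.norm_sub_le hc0 (s := s) (fun k hk => ?_) (hZ s _)) hm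
    rw [← ht k (Finset.mem_range.2 hk)]
    exact hZ t _ k hk
  let Φ : (ℕ → Bool) → julia (C c⁻¹ * (X ^ 2 - X)) := fun s => ⟨toP1 (Z s), hmem s⟩
  have hΦcont : Continuous Φ := (continuous_toP1.comp hcont).subtype_mk _
  have hinj : Function.Injective Φ := fun s t hst => by
    have hZst : Z s = Z t := toP1_injective (congrArg Subtype.val hst)
    funext k
    refine center_injective (hZ s (k + 1) k k.lt_succ_self) ?_
    rw [hZst]
    exact hZ t (k + 1) k k.lt_succ_self
  have hsurj : Function.Surjective Φ := by
    rintro ⟨x, hx⟩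
    obtain ⟨z, rfl, hz⟩ := (mem_julia_iff hc0 hc1).1 hx
    obtain ⟨s, hs⟩ := exists_itinerary hc0 hc1 hz
    refine ⟨s, Subtype.ext ?_⟩
    exact congrArg toP1 (eq_of_follows hc0 hc1 (hZ s) hs)
  have : T2Space (julia (C c⁻¹ * (X ^ 2 - X))) := t2Space_of_subset_unit fun x hx => by
    obtain ⟨z, rfl, hz⟩ := (mem_julia_iff hc0 hc1).1 hx
    exact ⟨z, rfl, hz 0⟩
  let e := Equiv.ofBijective Φ ⟨hinj, hsurj⟩
  have he : Continuous e := hΦcont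
  refine ⟨he.homeoOfEquivCompactToT2.symm, fun x hx => ?_⟩
  obtain ⟨s, hs⟩ := hsurj ⟨x, hx⟩
  obtain rfl : toP1 (Z s) = x := congrArg Subtype.val hs
  have hshift : polyMap (C c⁻¹ * (X ^ 2 - X)) (toP1 (Z s)) = toP1 (Z (shiftMap s)) :=
    (polyMap_toP1 c (Z s)).trans (congrArg toP1
      (eq_of_follows hc0 hc1 (fun n => (hZ s (n + 1)).quad) (hZ (shiftMap s))))
  refine ⟨hshift ▸ hmem _, ?_⟩
  have h1 : (⟨polyMap (C c⁻¹ * (X ^ 2 - X)) (toP1 (Z s)), hshift ▸ hmem _⟩ :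
      julia (C c⁻¹ * (X ^ 2 - X))) = e (shiftMap s) := Subtype.ext hshift
  have h2 : (⟨toP1 (Z s), hx⟩ : julia (C c⁻¹ * (X ^ 2 - X))) = e s := rfl
  rw [h1, h2]
  change e.symm (e (shiftMap s)) = shiftMap (e.symm (e s))
  rw [e.symm_apply_apply, e.symm_apply_apply]

end Dynamics

end QuadraticShift

/-- **Proposition 4.1.** For an odd prime `p`, the Julia set of `F(z) = z(z-1)/p` over
`ℂ_p` is non-empty and the dynamics of `F` on it is topologically conjugate to the shift
map on the two-symbol sequence space; in particular the Julia set is compact. -/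
theorem julia_conjugate_to_shift
    {p : ℕ} [Fact (Nat.Prime p)] (hodd : p ≠ 2) {K : Type*} [NormedField K] [IsAlgClosed K]
    [CompleteSpace K] [IsUltrametricDist K] [Algebra ℚ_[p] K]
    (hext : ∀ q : ℚ_[p], ‖algebraMap ℚ_[p] K q‖ = ‖q‖) :
    (julia (C ((p : K))⁻¹ * (X ^ 2 - X))).Nonempty ∧
    (∃ h : (julia (C ((p : K))⁻¹ * (X ^ 2 - X))) ≃ₜ (ℕ → Bool),
      ∀ (z : P1 K) (hz : z ∈ julia (C ((p : K))⁻¹ * (X ^ 2 - X))),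
        ∃ hfz : polyMap (C ((p : K))⁻¹ * (X ^ 2 - X)) z ∈
            julia (C ((p : K))⁻¹ * (X ^ 2 - X)),
          h ⟨polyMap (C ((p : K))⁻¹ * (X ^ 2 - X)) z, hfz⟩ = shiftMap (h ⟨z, hz⟩)) ∧
    IsCompact (julia (C ((p : K))⁻¹ * (X ^ 2 - X))) := by
  have hp : ‖(p : K)‖ = (p : ℝ)⁻¹ := by
    rw [← map_natCast (algebraMap ℚ_[p] K), hext, Padic.norm_p]
  have hp1 : 1 < (p : ℝ) := by exact_mod_cast (Fact.out : p.Prime).one_lt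
  obtain ⟨h, hh⟩ := QuadraticShift.exists_homeomorph_julia (c := (p : K))
    (by rw [hp]; positivity) (by rw [hp]; exact inv_lt_one_of_one_lt₀ hp1)
  refine ⟨⟨_, (h.symm fun _ => false).2⟩, ⟨h, hh⟩, ?_⟩
  rw [isCompact_iff_compactSpace]
  exact h.symm.compactSpace
end
end
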